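/- arXiv:2509.16744 — 3 statements merged into one kernel-verified Lean document; each statement's English description precedes it below -/
import Mathlib

section
/- Let n ∈ ℕ, let f : ℝⁿ → ℝⁿ, let S be a finite index set, and for each i ∈ S let φᵢ : ℝⁿ → ℂ be differentiable with complex numbers μᵢ and ηᵢ such that for every x ∈ ℝⁿ the Lie derivative satisfies (Dφᵢ(x))(f(x)) = μᵢ·φᵢ(x) (i.e., each φᵢ is a Koopman eigenfunction of the vector field f with eigenvalue μᵢ). Let λ ∈ ℝ satisfy μᵢ + λ ≠ 0 for all i ∈ S, and define h(x) = Σ_{i∈S} ηᵢ·φᵢ(x) and T(x) = Σ_{i∈S} (ηᵢ/(μᵢ+λ))·φᵢ(x). Then T is differentiable and for every x ∈ ℝⁿ, (DT(x))(f(x)) = −λ·T(x) + h(x); that is, T solves the scalar KKL observer PDE ∂T/∂x · f = −λT + h. -/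
/-- **KKL observer PDE solved by a linear combination of Koopman eigenfunctions.**
If each `φ i` (for `i` in a finite index set `S`) is a differentiable Koopman
eigenfunction of the vector field `f` with eigenvalue `μ i`, i.e. its Lie
derivative along `f` satisfies `(Dφᵢ x)(f x) = μᵢ · φᵢ x`, and `μᵢ + λ ≠ 0`
for all `i ∈ S`, then `T = ∑ᵢ (ηᵢ/(μᵢ+λ)) φᵢ` is differentiable and solves the
scalar KKL observer PDE `∂T/∂x · f = −λ T + h` for `h = ∑ᵢ ηᵢ φᵢ`. -/
theorem kkl_injection_from_koopman_eigenfunctions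
    {n : ℕ} {ι : Type*} (f : (Fin n → ℝ) → (Fin n → ℝ)) (S : Finset ι)
    (φ : ι → (Fin n → ℝ) → ℂ) (μ η : ι → ℂ)
    (hdiff : ∀ i ∈ S, Differentiable ℝ (φ i))
    (heig : ∀ i ∈ S, ∀ x : Fin n → ℝ, fderiv ℝ (φ i) x (f x) = μ i * φ i x)
    (l : ℝ) (hl : ∀ i ∈ S, μ i + (l : ℂ) ≠ 0)
    (h T : (Fin n → ℝ) → ℂ)
    (hh : ∀ x, h x = ∑ i ∈ S, η i * φ i x)
    (hT : ∀ x, T x = ∑ i ∈ S, (η i / (μ i + (l : ℂ))) * φ i x) :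
    Differentiable ℝ T ∧
      ∀ x : Fin n → ℝ, fderiv ℝ T x (f x) = -(l : ℂ) * T x + h x := by
  have hderiv (x : Fin n → ℝ) : HasFDerivAt T
      (∑ i ∈ S, (η i / (μ i + (l : ℂ))) • fderiv ℝ (φ i) x) x := by
    rw [funext hT]
    exact HasFDerivAt.fun_sum fun i hi => ((hdiff i hi x).hasFDerivAt).const_mul _
  refine ⟨fun x => (hderiv x).differentiableAt, fun x => ?_⟩
  rw [(hderiv x).fderiv, hT, hh, Finset.mul_sum, ← Finset.sum_add_distrib,
    sum_apply]
  refine Finset.sum_congr rfl fun i hi => ?_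
  have hne := hl i hi
  rw [smul_apply, heig i hi x, smul_eq_mul]
  field_simp
  ring
end

section
/- Let A : ℝ → ℝ be continuous, let A* ∈ ℝ, let m ∈ ℕ, and let s₀, y₀ ∈ ℝ. Define the flow of the system ẏ = A(s)y, ṡ = 1 by s(t) = s₀ + t and y(t) = y₀·exp(∫₀ᵗ A(s₀+τ)dτ), and define φ(y,s) = yᵐ·exp(−m·∫₀ˢ (A(u) − A*)du). Then for every t ∈ ℝ, φ(y(t), s(t)) = exp(m·A*·t)·φ(y₀, s₀); that is, φ is a Koopman eigenfunction of the flow with continuous-time eigenvalue m·A*. -/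
open intervalIntegral

/-- **Koopman eigenfunction of a planar limit-cycle flow (real eigenvalue).**
For the flow `s(t) = s₀ + t`, `y(t) = y₀ exp(∫₀ᵗ A(s₀+τ) dτ)` of the system
`ẏ = A(s)y, ṡ = 1`, the function `φ(y,s) = yᵐ exp(−m ∫₀ˢ (A(u) − A*) du)` is a
Koopman eigenfunction with continuous-time eigenvalue `m·A*`:
`φ(y(t), s(t)) = exp(m A* t) · φ(y₀, s₀)` for all `t`. -/
theorem koopman_eigenfunction_limit_cycle_real
    (A : ℝ → ℝ) (hA : Continuous A) (Astar : ℝ) (m : ℕ) (s₀ y₀ : ℝ)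
    (s y : ℝ → ℝ) (φ : ℝ → ℝ → ℝ)
    (hs : ∀ t : ℝ, s t = s₀ + t)
    (hy : ∀ t : ℝ, y t = y₀ * Real.exp (∫ τ in (0:ℝ)..t, A (s₀ + τ)))
    (hφ : ∀ Y S : ℝ,
      φ Y S = Y ^ m * Real.exp (-(m : ℝ) * ∫ u in (0:ℝ)..S, (A u - Astar))) :
    ∀ t : ℝ, φ (y t) (s t) = Real.exp ((m : ℝ) * Astar * t) * φ y₀ s₀ := by
  intro t
  have hshift : ∫ τ in (0:ℝ)..t, A (s₀ + τ) = ∫ u in s₀..(s₀ + t), A u := by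
    rw [integral_comp_add_left, add_zero]
  have hsub : ∀ S : ℝ, ∫ u in (0:ℝ)..S, (A u - Astar) = (∫ u in (0:ℝ)..S, A u) - S * Astar := by
    intro S
    rw [integral_sub (hA.intervalIntegrable _ _) intervalIntegrable_const, integral_const,
      sub_zero, smul_eq_mul]
  have hadd : ∫ u in (0:ℝ)..(s₀ + t), A u =
      (∫ u in (0:ℝ)..s₀, A u) + ∫ u in s₀..(s₀ + t), A u :=
    (integral_add_adjacent_intervals (hA.intervalIntegrable _ _)
      (hA.intervalIntegrable _ _)).symm
  rw [hφ, hφ, hs, hy, hshift, hsub, hsub, hadd, mul_pow, ← Real.exp_nat_mul, mul_assoc,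
    ← Real.exp_add, mul_left_comm, ← Real.exp_add]
  congr 2
  ring
end

section
/- Let A : ℝ → ℝ be continuous, let A* ∈ ℝ, let m ∈ ℕ, n ∈ ℤ, and let s₀, y₀ ∈ ℝ. Define s(t) = s₀ + t and y(t) = y₀·exp(∫₀ᵗ A(s₀+τ)dτ), and define the complex-valued function φ(y,s) = yᵐ·exp(−m·∫₀ˢ (A(u) − A*)du)·exp(i·n·s). Then for every t ∈ ℝ, φ(y(t), s(t)) = exp((m·A* + i·n)·t)·φ(y₀, s₀); that is, φ(y,s;m,n) is a Koopman eigenfunction of the flow of ẏ = A(s)y, ṡ = 1 with continuous-time eigenvalue m·A* + i·n. -/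
open intervalIntegral Complex

/-- **Koopman eigenfunction of a planar limit-cycle flow (complex eigenvalue).**
For the flow `s(t) = s₀ + t`, `y(t) = y₀ exp(∫₀ᵗ A(s₀+τ) dτ)` of the system
`ẏ = A(s)y, ṡ = 1`, the complex-valued function
`φ(y,s) = yᵐ exp(−m ∫₀ˢ (A(u) − A*) du) · exp(i n s)` is a Koopman
eigenfunction with continuous-time eigenvalue `m·A* + i·n`:
`φ(y(t), s(t)) = exp((m A* + i n) t) · φ(y₀, s₀)` for all `t`. -/
theorem koopman_eigenfunction_limit_cycle_complex
    (A : ℝ → ℝ) (hA : Continuous A) (Astar : ℝ) (m : ℕ) (n : ℤ) (s₀ y₀ : ℝ)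
    (s y : ℝ → ℝ) (φ : ℝ → ℝ → ℂ)
    (hs : ∀ t : ℝ, s t = s₀ + t)
    (hy : ∀ t : ℝ, y t = y₀ * Real.exp (∫ τ in (0:ℝ)..t, A (s₀ + τ)))
    (hφ : ∀ Y S : ℝ,
      φ Y S = (Y : ℂ) ^ m *
        Complex.exp (-(m : ℂ) * ((∫ u in (0:ℝ)..S, (A u - Astar) : ℝ) : ℂ)) *
        Complex.exp (Complex.I * (n : ℂ) * (S : ℂ))) :
    ∀ t : ℝ,
      φ (y t) (s t) =
        Complex.exp (((m : ℂ) * (Astar : ℂ) + Complex.I * (n : ℂ)) * (t : ℂ)) *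
          φ y₀ s₀ := by
  intro t
  have hB : Continuous fun u => A u - Astar := hA.sub continuous_const
  have hsplit : ∫ u in (0:ℝ)..(s₀ + t), (A u - Astar) =
      (∫ u in (0:ℝ)..s₀, (A u - Astar)) + ((∫ τ in (0:ℝ)..t, A (s₀ + τ)) - t * Astar) := by
    rw [← integral_add_adjacent_intervals (hB.intervalIntegrable 0 s₀)
      (hB.intervalIntegrable s₀ (s₀ + t))]
    congr 1
    rw [integral_sub (hA.intervalIntegrable _ _) intervalIntegrable_const,
      integral_comp_add_left A s₀]
    simp
  rw [hφ, hφ, hs, hy, hsplit]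
  push_cast
  rw [mul_pow, ← Complex.exp_nat_mul]
  have hrearrange : ∀ p a b c d e f : ℂ, a + b + c = d + (e + f) →
      p * exp a * exp b * exp c = exp d * (p * exp e * exp f) := by
    intro p a b c d e f h
    have := congrArg exp h
    simp only [exp_add] at this
    linear_combination p * this
  apply hrearrange
  ring
end
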